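/- arXiv:2105.08392 — 4 statements merged into one kernel-verified Lean document; each statement's English description precedes it below -/
import Mathlib

section
/- Let f : ℝ → ℝ be infinitely differentiable and satisfy the similarity equation f'''(η) = 1 - (f'(η))² + f(η)·f''(η) for all η. If at some point η₀ we have f'(η₀) = 1 and f''(η₀) = 0, then every derivative of f of order at least 2 vanishes at η₀, i.e. for every n ≥ 2, the n-th derivative of f at η₀ equals 0. -/
/-- If a smooth function `u` solves a second-order linear homogeneous equation with smooth
coefficients and vanishes to first order at `x`, then it vanishes to infinite order at `x`. -/
theorem iteratedDeriv_eq_zero_of_linear_ode {a b u : ℝ → ℝ} (ha : ContDiff ℝ (⊤ : ℕ∞) a)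
    (hb : ContDiff ℝ (⊤ : ℕ∞) b) (hu : ContDiff ℝ (⊤ : ℕ∞) u)
    (hode : deriv (deriv u) = a * u + b * deriv u) {x : ℝ} (h0 : u x = 0) (h1 : deriv u x = 0)
    (n : ℕ) : iteratedDeriv n u x = 0 := by
  have hu' : ContDiff ℝ (⊤ : ℕ∞) (deriv u) := (contDiff_infty_iff_deriv.1 hu).2
  have smooth {g : ℝ → ℝ} (hg : ContDiff ℝ (⊤ : ℕ∞) g) (k : ℕ) : ContDiffAt ℝ k g x :=
    (contDiff_infty.1 hg k).contDiffAt
  induction n using Nat.strong_induction_on with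
  | _ n ih =>
    match n with
    | 0 => simpa using h0
    | 1 => simpa using h1
    | k + 2 =>
      rw [iteratedDeriv_succ', iteratedDeriv_succ', hode,
        iteratedDeriv_add (f := a * u) (g := b * deriv u)
          ((smooth ha k).mul (smooth hu k)) ((smooth hb k).mul (smooth hu' k)),
        iteratedDeriv_mul (smooth ha k) (smooth hu k),
        iteratedDeriv_mul (smooth hb k) (smooth hu' k),
        Finset.sum_eq_zero, Finset.sum_eq_zero, add_zero]
      · intro i _
        rw [← iteratedDeriv_succ', ih _ (by omega), mul_zero]
      · intro i _
        rw [ih _ (by omega), mul_zero]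


/-- If a smooth `f` satisfies the rear stagnation-point similarity equation
`f''' = 1 - (f')² + f·f''` and at some `η₀` we have `f'(η₀) = 1`, `f''(η₀) = 0`,
then every derivative of `f` of order at least `2` vanishes at `η₀`. -/
theorem stmt_0 (f : ℝ → ℝ) (hf : ContDiff ℝ (⊤ : ℕ∞) f)
    (hode : ∀ η : ℝ,
      iteratedDeriv 3 f η = 1 - (deriv f η) ^ 2 + f η * iteratedDeriv 2 f η)
    (η₀ : ℝ) (h1 : deriv f η₀ = 1) (h2 : iteratedDeriv 2 f η₀ = 0) :
    ∀ n : ℕ, 2 ≤ n → iteratedDeriv n f η₀ = 0 := by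
  intro n hn
  have hf' : ContDiff ℝ (⊤ : ℕ∞) (deriv f) := (contDiff_infty_iff_deriv.1 hf).2
  have hd : deriv (fun η ↦ deriv f η - 1) = deriv (deriv f) := by
    funext η
    exact deriv_sub_const (1 : ℝ)
  have e2 : iteratedDeriv 2 f = deriv (deriv f) := by
    rw [iteratedDeriv_succ', iteratedDeriv_one]
  have e3 : iteratedDeriv 3 f = deriv (deriv (deriv f)) := by
    rw [iteratedDeriv_succ, e2]
  obtain ⟨m, rfl⟩ := Nat.exists_eq_add_of_le' hn
  have h := iteratedDeriv_eq_zero_of_linear_ode (a := fun η ↦ -(deriv f η + 1)) (b := f)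
    (u := fun η ↦ deriv f η - 1) (hf'.add contDiff_const).neg hf (hf'.sub contDiff_const)
    (by
      rw [hd]
      funext η
      have := hode η
      rw [e2, e3] at this
      simp only [Pi.add_apply, Pi.mul_apply]
      linear_combination this)
    (x := η₀) (by simp [h1]) (by rw [hd, ← e2, h2]) (m + 1)
  rwa [iteratedDeriv_succ', hd, ← iteratedDeriv_succ', ← iteratedDeriv_succ'] at h
end

section
/- Let f : ℝ → ℝ be real-analytic and satisfy the similarity equation f'''(η) = 1 - (f'(η))² + f(η)·f''(η) for all η. If at some point η₀ we have f'(η₀) = 1 and f''(η₀) = 0, then f'(η) = 1 for all η ∈ ℝ. -/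
/-- Uniqueness of the zero solution of a homogeneous linear second-order initial value problem
with continuous coefficients. -/
theorem eq_zero_of_second_order_linear_ode {a b y z : ℝ → ℝ} (ha : Continuous a)
    (hb : Continuous b) (hy : ∀ t, HasDerivAt y (z t) t)
    (hz : ∀ t, HasDerivAt z (a t * y t + b t * z t) t) {t₀ : ℝ} (hy₀ : y t₀ = 0)
    (hz₀ : z t₀ = 0) (t : ℝ) : y t = 0 := by
  obtain ⟨A, B, ht, ht₀⟩ : ∃ A B, t ∈ Set.Ioo A B ∧ t₀ ∈ Set.Ioo A B :=
    ⟨min t t₀ - 1, max t t₀ + 1, by grind, by grind⟩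
  obtain ⟨M, hM⟩ := (isCompact_Icc (a := A) (b := B)).exists_bound_of_continuousOn ha.continuousOn
  obtain ⟨N, hN⟩ := (isCompact_Icc (a := A) (b := B)).exists_bound_of_continuousOn hb.continuousOn
  have hM₀ : 0 ≤ M := (norm_nonneg _).trans (hM t (Set.Ioo_subset_Icc_self ht))
  have hN₀ : 0 ≤ N := (norm_nonneg _).trans (hN t (Set.Ioo_subset_Icc_self ht))
  have hlip : ∀ s ∈ Set.Ioo A B, LipschitzOnWith (Real.toNNReal (1 + M + N))
      (fun p : ℝ × ℝ ↦ (p.2, a s * p.1 + b s * p.2)) Set.univ := by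
    intro s hs
    refine LipschitzOnWith.of_dist_le_mul fun p _ q _ ↦ ?_
    rw [Real.coe_toNNReal _ (by positivity)]
    have h₁ : |p.1 - q.1| ≤ dist p q := le_max_left (dist p.1 q.1) (dist p.2 q.2)
    have h₂ : |p.2 - q.2| ≤ dist p q := le_max_right (dist p.1 q.1) (dist p.2 q.2)
    have hd : 0 ≤ dist p q := dist_nonneg
    have has : |a s| ≤ M := hM s (Set.Ioo_subset_Icc_self hs)
    have hbs : |b s| ≤ N := hN s (Set.Ioo_subset_Icc_self hs)
    refine max_le ?_ ?_
    · calc |p.2 - q.2| ≤ dist p q := h₂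
        _ ≤ (1 + M + N) * dist p q := le_mul_of_one_le_left hd (by linarith)
    · calc |a s * p.1 + b s * p.2 - (a s * q.1 + b s * q.2)|
          = |a s * (p.1 - q.1) + b s * (p.2 - q.2)| := by ring_nf
        _ ≤ |a s| * |p.1 - q.1| + |b s| * |p.2 - q.2| := by
          simpa only [abs_mul] using abs_add_le (a s * (p.1 - q.1)) (b s * (p.2 - q.2))
        _ ≤ M * dist p q + N * dist p q := by gcongr
        _ ≤ (1 + M + N) * dist p q := by linarith
  have heq := ODE_solution_unique_of_mem_Ioo (f := fun s ↦ (y s, z s)) (g := fun _ ↦ (0, 0))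
    hlip ht₀ (fun s _ ↦ ⟨(hy s).prodMk (hz s), Set.mem_univ _⟩)
    (fun s _ ↦ ⟨by simpa [← Prod.zero_eq_mk] using hasDerivAt_const s (0 : ℝ × ℝ), Set.mem_univ _⟩)
    (by simp [hy₀, hz₀]) ht
  exact congrArg Prod.fst heq


/-- If a real-analytic `f` satisfies the rear stagnation-point similarity equation
`f''' = 1 - (f')² + f·f''` and at some `η₀` we have `f'(η₀) = 1`, `f''(η₀) = 0`,
then `f' ≡ 1` on all of `ℝ`. -/
theorem stmt_1 (f : ℝ → ℝ) (hf : ∀ x : ℝ, AnalyticAt ℝ f x)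
    (hode : ∀ η : ℝ,
      iteratedDeriv 3 f η = 1 - (deriv f η) ^ 2 + f η * iteratedDeriv 2 f η)
    (η₀ : ℝ) (h1 : deriv f η₀ = 1) (h2 : iteratedDeriv 2 f η₀ = 0) :
    ∀ η : ℝ, deriv f η = 1 := by
  rw [iteratedDeriv_succ, iteratedDeriv_one] at h2
  have hderiv (x : ℝ) : HasDerivAt (deriv f) (deriv (deriv f) x) x :=
    (hf x).deriv.differentiableAt.hasDerivAt
  have hderiv₂ (x : ℝ) : HasDerivAt (deriv (deriv f))
      (-(deriv f x + 1) * (deriv f x - 1) + f x * deriv (deriv f) x) x := by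
    have h := hode x
    simp only [iteratedDeriv_succ, iteratedDeriv_zero] at h
    exact (hf x).deriv.deriv.differentiableAt.hasDerivAt.congr_deriv (h.trans (by ring))
  have hcont : Continuous f := continuous_iff_continuousAt.2 fun x ↦ (hf x).continuousAt
  have hcont' : Continuous (deriv f) :=
    continuous_iff_continuousAt.2 fun x ↦ (hderiv x).continuousAt
  intro η
  exact sub_eq_zero.1 <| eq_zero_of_second_order_linear_ode (hcont'.add_const 1).neg hcont
    (fun x ↦ (hderiv x).sub_const 1) hderiv₂ (sub_eq_zero.2 h1) h2 η
end

section
/- The function f : ℝ → ℝ defined by f(η) = −η/3 + (1/3)·(1 − exp(−η)) satisfies the unsteady similarity equation with κ = 2/3, namely f'''(η) − f(η)·f''(η) − 1 + (f'(η))² = (2/3)·(f'(η) + (η/2)·f''(η) − 1) for all η, together with the wall boundary conditions f(0) = 0 and f'(0) = 0. -/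
theorem hasDerivAt_exp_neg (x : ℝ) :
    HasDerivAt (fun η : ℝ => Real.exp (-η)) (-Real.exp (-x)) x := by
  simpa using (hasDerivAt_neg x).exp

/-- `f(η) = -η/3 + (1/3)(1 - e^{-η})` satisfies the unsteady similarity equation with
`κ = 2/3` together with the wall boundary conditions `f(0) = 0`, `f'(0) = 0`. -/
theorem stmt_7 (f : ℝ → ℝ)
    (hf : f = fun η => -η / 3 + (1 / 3) * (1 - Real.exp (-η))) :
    (∀ η : ℝ,
      iteratedDeriv 3 f η - f η * iteratedDeriv 2 f η - 1 + (deriv f η) ^ 2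
        = (2 / 3) * (deriv f η + η / 2 * iteratedDeriv 2 f η - 1)) ∧
    f 0 = 0 ∧ deriv f 0 = 0 := by
  have h1 : deriv f = fun η => -1 / 3 + (1 / 3) * Real.exp (-η) := by
    funext x
    rw [hf]
    refine (((hasDerivAt_neg x).div_const 3).add
      (((hasDerivAt_exp_neg x).const_sub 1).const_mul (1 / 3))).deriv.trans ?_
    ring
  have h2 : iteratedDeriv 2 f = fun η => -(1 / 3) * Real.exp (-η) := by
    funext x
    rw [iteratedDeriv_succ, iteratedDeriv_one, h1]
    refine (((hasDerivAt_exp_neg x).const_mul (1 / 3)).const_add (-1 / 3)).deriv.trans ?_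
    ring
  have h3 : iteratedDeriv 3 f = fun η => (1 / 3) * Real.exp (-η) := by
    funext x
    rw [iteratedDeriv_succ, h2]
    refine ((hasDerivAt_exp_neg x).const_mul (-(1 / 3))).deriv.trans ?_
    ring
  refine ⟨fun η => ?_, ?_, ?_⟩
  · rw [h3, h2, h1, hf]
    ring
  · simp [hf]
  · rw [h1]
    norm_num
end

section
/- The complex-valued function F : ℝ → ℂ defined by F(η) = (exp(−√3·i·η) − 1)/(√3·i) satisfies the autonomous equation F'''(η) − F(η)·F''(η) + (F'(η))² + 4·F'(η) = 0 for all real η, where primes denote derivatives with respect to the real variable η. -/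
theorem hasDerivAt_cexp_neg_mul_ofReal (c : ℂ) (x : ℝ) :
    HasDerivAt (fun t : ℝ => Complex.exp (-(c * (t : ℂ))))
      (-c * Complex.exp (-(c * (x : ℂ)))) x := by
  have h := (((hasDerivAt_id (x : ℂ)).const_mul c).neg.cexp).comp_ofReal
  simpa [mul_comm] using h

/-- `F(η) = (e^{-√3·i·η} - 1)/(√3·i)` satisfies the `κ = -2` autonomous equation
`F''' - F·F'' + (F')² + 4F' = 0`, derivatives being taken with respect to the real
variable `η`. -/
theorem stmt_9 (F : ℝ → ℂ)
    (hF : F = fun η : ℝ =>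
      (Complex.exp (-((Real.sqrt 3 : ℂ) * Complex.I * (η : ℂ))) - 1)
        / ((Real.sqrt 3 : ℂ) * Complex.I)) :
    ∀ η : ℝ,
      iteratedDeriv 3 F η - F η * iteratedDeriv 2 F η + (deriv F η) ^ 2
        + 4 * deriv F η = 0 := by
  subst hF
  intro η
  have hc : (Real.sqrt 3 : ℂ) * Complex.I ≠ 0 := by simp
  have hsq : ((Real.sqrt 3 : ℂ) * Complex.I) ^ 2 = -3 := by
    rw [mul_pow, Complex.I_sq, ← Complex.ofReal_pow, Real.sq_sqrt (by norm_num)]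
    norm_num
  generalize (Real.sqrt 3 : ℂ) * Complex.I = c at hc hsq ⊢
  have h1 : deriv (fun t : ℝ => (Complex.exp (-(c * (t : ℂ))) - 1) / c)
      = fun t : ℝ => -Complex.exp (-(c * (t : ℂ))) := by
    funext t
    rw [(((hasDerivAt_cexp_neg_mul_ofReal c t).sub_const 1).div_const c).deriv]
    field_simp
  have h2 : deriv (fun t : ℝ => -Complex.exp (-(c * (t : ℂ))))
      = fun t : ℝ => c * Complex.exp (-(c * (t : ℂ))) := by
    funext t
    rw [(hasDerivAt_cexp_neg_mul_ofReal c t).fun_neg.deriv]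
    ring
  have h3 : deriv (fun t : ℝ => c * Complex.exp (-(c * (t : ℂ)))) η
      = 3 * Complex.exp (-(c * (η : ℂ))) := by
    rw [((hasDerivAt_cexp_neg_mul_ofReal c η).const_mul c).deriv]
    linear_combination (-Complex.exp (-(c * (η : ℂ)))) * hsq
  simp only [iteratedDeriv_succ, iteratedDeriv_zero, h1, h2, h3]
  field_simp
  ring
end
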